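/- arXiv:1907.08933 — 5 statements merged into one kernel-verified Lean document; each statement's English description precedes it below -/
import Mathlib

section
/- Let V be a finite-dimensional real vector space, K ⊆ V a compact convex set, and f, g effects on K. Then the pair (f, g) admits a witness square if and only if there exist affine maps ι : S → K and Π : K → S such that Π ∘ ι = id_S and, for all s ∈ S, f(ι(s)) = π₀(s) and g(ι(s)) = π₁(s). (This characterizes maximal incompatibility of the two-outcome measurements given by f and g.) -/
open Set

/-- An effect on `K`: an affine map `V → ℝ` with values in `[0,1]` on `K`. -/
def IsEffect {V : Type*} [AddCommGroup V] [Module ℝ V]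
    (K : Set V) (f : V →ᵃ[ℝ] ℝ) : Prop :=
  ∀ x ∈ K, 0 ≤ f x ∧ f x ≤ 1

/-- A witness square for the pair of effects `(f, g)` on `K`: four points
`x i j ∈ K` with `x 0 0 + x 1 1 = x 1 0 + x 0 1`, `f (x i j) = i` and `g (x i j) = j`. -/
def IsWitnessSquare {V : Type*} [AddCommGroup V] [Module ℝ V]
    (K : Set V) (f g : V →ᵃ[ℝ] ℝ) (x : Fin 2 → Fin 2 → V) : Prop :=
  (∀ i j, x i j ∈ K) ∧ x 0 0 + x 1 1 = x 1 0 + x 0 1 ∧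
    (∀ i j, f (x i j) = ((i : ℕ) : ℝ)) ∧ (∀ i j, g (x i j) = ((j : ℕ) : ℝ))

/-- The square state space `S = [0,1]² ⊆ ℝ²`. -/
def squareS : Set (ℝ × ℝ) := Icc (0:ℝ) 1 ×ˢ Icc (0:ℝ) 1

/-- The affine map `ℝ × ℝ → V` sending `(0, 0)`, `(1, 0)`, `(0, 1)` to `a`, `b`, `c`. -/
noncomputable def affineFrame {V : Type*} [AddCommGroup V] [Module ℝ V] (a b c : V) :
    (ℝ × ℝ) →ᵃ[ℝ] V :=
  ((LinearMap.toSpanSingleton ℝ V (b - a)).coprod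
    (LinearMap.toSpanSingleton ℝ V (c - a))).toAffineMap + AffineMap.const ℝ (ℝ × ℝ) a

lemma affineFrame_apply {V : Type*} [AddCommGroup V] [Module ℝ V] (a b c : V) (s : ℝ × ℝ) :
    affineFrame a b c s = s.1 • (b - a) + s.2 • (c - a) + a := by
  simp [affineFrame]

lemma AffineMap.map_affineFrame {V : Type*} [AddCommGroup V] [Module ℝ V]
    (h : V →ᵃ[ℝ] ℝ) (a b c : V) (s : ℝ × ℝ) :
    h (affineFrame a b c s) = s.1 * (h b - h a) + s.2 * (h c - h a) + h a := by
  have hv (u w : V) : h.linear (u - w) = h u - h w := h.linearMap_vsub u w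
  have hadd (u : V) : h (u + a) = h.linear u + h a := h.map_vadd a u
  rw [affineFrame_apply, hadd, map_add, map_smul, map_smul, hv, hv, smul_eq_mul, smul_eq_mul]

/-- A convex set containing the vertices of a parallelogram contains the parallelogram. -/
lemma Convex.affineFrame_mem {V : Type*} [AddCommGroup V] [Module ℝ V] {K : Set V}
    (hK : Convex ℝ K) {a b c d : V} (ha : a ∈ K) (hb : b ∈ K) (hc : c ∈ K) (hd : d ∈ K)
    (h : a + d = b + c) {s : ℝ × ℝ} (hs : s ∈ squareS) : affineFrame a b c s ∈ K := by
  obtain ⟨⟨h0, h1⟩, h2, h3⟩ := hs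
  have hbot := hK ha hb (sub_nonneg.2 h1) h0 (sub_add_cancel 1 s.1)
  have htop := hK hc hd (sub_nonneg.2 h1) h0 (sub_add_cancel 1 s.1)
  convert hK hbot htop (sub_nonneg.2 h3) h2 (sub_add_cancel 1 s.2) using 1
  obtain rfl : d = b + c - a := eq_sub_of_add_eq' h
  rw [affineFrame_apply]
  module

/-- A pair of effects `(f, g)` on a compact convex set `K` in a finite-dimensional real
vector space admits a witness square (equivalently, the corresponding two-outcome
measurements are maximally incompatible) if and only if there are affine maps
`ι : S → K` and `Π : K → S` with `Π ∘ ι = id_S`, and `f (ι s) = π₀ s`, `g (ι s) = π₁ s`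
for all `s ∈ S`, where `π₀, π₁` are the coordinate effects on the square `S`. -/
theorem witnessSquare_iff_embedding_of_square
    {V : Type*} [NormedAddCommGroup V] [NormedSpace ℝ V] [FiniteDimensional ℝ V]
    (K : Set V) (hK : IsCompact K) (hKconv : Convex ℝ K)
    (f g : V →ᵃ[ℝ] ℝ) (hf : IsEffect K f) (hg : IsEffect K g) :
    (∃ x : Fin 2 → Fin 2 → V, IsWitnessSquare K f g x) ↔
      ∃ (ι : (ℝ × ℝ) →ᵃ[ℝ] V) (P : V →ᵃ[ℝ] ℝ × ℝ),
        (∀ s ∈ squareS, ι s ∈ K) ∧ (∀ x ∈ K, P x ∈ squareS) ∧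
        (∀ s ∈ squareS, P (ι s) = s) ∧
        (∀ s ∈ squareS, f (ι s) = s.1) ∧ (∀ s ∈ squareS, g (ι s) = s.2) := by
  constructor
  · rintro ⟨x, hx, hsum, hfx, hgx⟩
    have hfι (s : ℝ × ℝ) : f (affineFrame (x 0 0) (x 1 0) (x 0 1) s) = s.1 := by
      simp [AffineMap.map_affineFrame, hfx]
    have hgι (s : ℝ × ℝ) : g (affineFrame (x 0 0) (x 1 0) (x 0 1) s) = s.2 := by
      simp [AffineMap.map_affineFrame, hgx]
    exact ⟨affineFrame (x 0 0) (x 1 0) (x 0 1), f.prod g,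
      fun s hs => hKconv.affineFrame_mem (hx 0 0) (hx 1 0) (hx 0 1) (hx 1 1) hsum hs,
      fun y hy => ⟨hf y hy, hg y hy⟩, fun s _ => Prod.ext (hfι s) (hgι s),
      fun s _ => hfι s, fun s _ => hgι s⟩
  · rintro ⟨ι, -, hι, -, -, hfι, hgι⟩
    have hs (i j : Fin 2) : (((i : ℕ) : ℝ), ((j : ℕ) : ℝ)) ∈ squareS := by
      fin_cases i <;> fin_cases j <;> simp [squareS]
    refine ⟨fun i j => ι (((i : ℕ) : ℝ), ((j : ℕ) : ℝ)), fun i j => hι _ (hs i j), ?_,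
      fun i j => hfι _ (hs i j), fun i j => hgι _ (hs i j)⟩
    have hdec (s : ℝ × ℝ) : ι s = ι.linear s + ι 0 := congrFun ι.decomp s
    have hlin : ι.linear (1, 1) = ι.linear (1, 0) + ι.linear (0, 1) := by
      rw [← map_add]; simp
    have h0 : ι.linear (0, 0) = 0 := ι.linear.map_zero
    simp only [Fin.val_zero, Fin.val_one, Nat.cast_zero, Nat.cast_one]
    rw [hdec (0, 0), hdec (1, 1), hdec (1, 0), hdec (0, 1), hlin, h0]
    abel
end

section
/- Let V be a finite-dimensional real vector space, K ⊆ V a compact convex set, and let (f_A, f_{A'}) and (f_B, f_{B'}) be two pairs of effects on K admitting witness squares {x_{ij}} and {y_{ij}} respectively (i, j ∈ {0,1}). Then there exists an affine map T : K → K such that T(y_{ij}) = x_{ij} for all i, j ∈ {0,1}, f_A ∘ T = f_B and f_{A'} ∘ T = f_{B'} on K. -/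
/-- The point with coordinates `(s, t)` in the parallelogram based at `p` with edges
`a - p` and `b - p`, in terms of the values of an affine function at `p`, `a` and `b`. -/
theorem AffineMap.apply_parallelogram_point {V : Type*} [AddCommGroup V] [Module ℝ V]
    (f : V →ᵃ[ℝ] ℝ) (p a b : V) (s t : ℝ) :
    f (p + (s • (a - p) + t • (b - p))) = f p + (s * (f a - f p) + t * (f b - f p)) := by
  have hlin (u w : V) : f.linear (u - w) = f u - f w := f.linearMap_vsub u w
  have h := f.map_vadd p (s • (a - p) + t • (b - p))
  rw [vadd_eq_add, vadd_eq_add, f.linear.map_add,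
    f.linear.map_smul, f.linear.map_smul, hlin, hlin] at h
  rw [add_comm p, h, smul_eq_mul, smul_eq_mul, add_comm]

/-- A convex set containing the vertices of a parallelogram contains all its points. -/
theorem Convex.parallelogram_point_mem {V : Type*} [AddCommGroup V] [Module ℝ V]
    {K : Set V} (hK : Convex ℝ K) {p a b c : V} (hp : p ∈ K) (ha : a ∈ K) (hb : b ∈ K)
    (hc : c ∈ K) (h : p + c = a + b) {s t : ℝ} (hs : 0 ≤ s) (hs' : s ≤ 1) (ht : 0 ≤ t)
    (ht' : t ≤ 1) : p + (s • (a - p) + t • (b - p)) ∈ K := by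
  obtain rfl : c = a + b - p := eq_sub_of_add_eq' h
  have h₀ : (1 - t) • p + t • b ∈ K := hK hp hb (by linarith) ht (by ring)
  have h₁ : (1 - t) • a + t • (a + b - p) ∈ K := hK ha hc (by linarith) ht (by ring)
  convert hK h₀ h₁ (sub_nonneg.mpr hs') hs (by ring) using 1
  module

/-- Given two pairs of effects `(f_A, f_{A'})` and `(f_B, f_{B'})` on a compact convex `K`
admitting witness squares `{x i j}` and `{y i j}`, there is an affine map `T : K → K`
with `T (y i j) = x i j`, `f_A ∘ T = f_B` and `f_{A'} ∘ T = f_{B'}` on `K`. -/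
theorem exists_affine_map_between_maximally_incompatible_pairs
    {V : Type*} [NormedAddCommGroup V] [NormedSpace ℝ V] [FiniteDimensional ℝ V]
    (K : Set V) (hK : IsCompact K) (hKconv : Convex ℝ K)
    (fA fA' fB fB' : V →ᵃ[ℝ] ℝ)
    (hfA : IsEffect K fA) (hfA' : IsEffect K fA')
    (hfB : IsEffect K fB) (hfB' : IsEffect K fB')
    (x y : Fin 2 → Fin 2 → V)
    (hx : IsWitnessSquare K fA fA' x) (hy : IsWitnessSquare K fB fB' y) :
    ∃ T : V →ᵃ[ℝ] V, (∀ v ∈ K, T v ∈ K) ∧ (∀ i j, T (y i j) = x i j) ∧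
      (∀ v ∈ K, fA (T v) = fB v) ∧ (∀ v ∈ K, fA' (T v) = fB' v) := by
  obtain ⟨hxK, hxs, hxf, hxg⟩ := hx
  obtain ⟨-, -, hyf, hyg⟩ := hy
  let T : V →ᵃ[ℝ] V := AffineMap.const ℝ V (x 0 0) +
    ((LinearMap.toSpanSingleton ℝ V (x 1 0 - x 0 0)).toAffineMap.comp fB +
      (LinearMap.toSpanSingleton ℝ V (x 0 1 - x 0 0)).toAffineMap.comp fB')
  have hT (v : V) :
      T v = x 0 0 + (fB v • (x 1 0 - x 0 0) + fB' v • (x 0 1 - x 0 0)) := rfl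
  have hx₁₁ : x 1 1 = x 1 0 + x 0 1 - x 0 0 := eq_sub_of_add_eq' hxs
  refine ⟨T, fun v hv => ?_, fun i j => ?_, fun v _ => ?_, fun v _ => ?_⟩
  · rw [hT]
    exact hKconv.parallelogram_point_mem (hxK 0 0) (hxK 1 0) (hxK 0 1) (hxK 1 1) hxs
      (hfB v hv).1 (hfB v hv).2 (hfB' v hv).1 (hfB' v hv).2
  · rw [hT, hyf, hyg]
    fin_cases i <;> fin_cases j <;> simp [hx₁₁]
    abel
  · rw [hT, AffineMap.apply_parallelogram_point, hxf, hxf, hxf]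
    simp
  · rw [hT, AffineMap.apply_parallelogram_point, hxg, hxg, hxg]
    simp
end

section
/- Let P(ε, η | C, D) ≥ 0, for ε, η ∈ {−1, 1}, C ∈ {A, A'}, D ∈ {B, B'}, be a non-signaling box, i.e., Σ_{ε,η} P(ε, η | C, D) = 1 for every (C, D), Σ_η P(ε, η | C, B) = Σ_η P(ε, η | C, B') for all ε, C, and Σ_ε P(ε, η | A, D) = Σ_ε P(ε, η | A', D) for all η, D. Define correlations E(C, D) = Σ_{ε,η} ε η P(ε, η | C, D) and X = E(A,B) + E(A,B') + E(A',B) − E(A',B'). If X = 4, then P(ε, η | C, D) = 1/2 whenever either (C, D) ≠ (A', B') and εη = 1, or (C, D) = (A', B') and εη = −1, and P(ε, η | C, D) = 0 otherwise. -/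
/-- Outcome value of a two-outcome box: `false ↦ +1`, `true ↦ -1`. -/
def sgn (b : Bool) : ℝ := if b then -1 else 1

/-- The correlation `E(C, D)` of a non-local box `P`, where the measurement choices
`C, D : Bool` are `false = A` (resp. `B`) and `true = A'` (resp. `B'`), and the
outcomes `ε, η : Bool` have values `sgn ε, sgn η ∈ {1, -1}`. -/
noncomputable def corr (P : Bool → Bool → Bool → Bool → ℝ) (C D : Bool) : ℝ :=
  ∑ ε : Bool, ∑ η : Bool, sgn ε * sgn η * P ε η C D

/-- If a non-signaling box attains the algebraic maximum `X_CHSH = 4` of the CHSH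
quantity, then it is the Popescu–Rohrlich box: `P(ε, η | C, D) = 1/2` when
`(C,D) ≠ (A',B')` and `εη = 1` or `(C,D) = (A',B')` and `εη = -1`, and `0` otherwise. -/
theorem chsh_max_implies_PR_box
    (P : Bool → Bool → Bool → Bool → ℝ)
    (hpos : ∀ ε η C D, 0 ≤ P ε η C D)
    (hnorm : ∀ C D, ∑ ε : Bool, ∑ η : Bool, P ε η C D = 1)
    (hnsA : ∀ ε C, ∑ η : Bool, P ε η C false = ∑ η : Bool, P ε η C true)
    (hnsB : ∀ η D, ∑ ε : Bool, P ε η false D = ∑ ε : Bool, P ε η true D)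
    (hX : corr P false false + corr P false true + corr P true false
        - corr P true true = 4) :
    ∀ ε η C D, P ε η C D =
      if (¬(C = true ∧ D = true) ∧ ε = η) ∨ ((C = true ∧ D = true) ∧ ε ≠ η)
      then 1/2 else 0 := by
  simp only [corr, sgn, Fintype.sum_bool, if_true, Bool.false_eq_true, if_false] at *
  simp only [Bool.forall_bool] at *
  obtain ⟨⟨⟨⟨_, _⟩, _, _⟩, ⟨_, _⟩, _, _⟩, ⟨⟨_, _⟩, _, _⟩, ⟨_, _⟩, _, _⟩ := hpos
  obtain ⟨⟨_, _⟩, _, _⟩ := hnorm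
  obtain ⟨⟨_, _⟩, _, _⟩ := hnsA
  obtain ⟨⟨_, _⟩, _, _⟩ := hnsB
  norm_num
  refine ⟨⟨⟨⟨?_, ?_⟩, ?_, ?_⟩, ⟨?_, ?_⟩, ?_, ?_⟩, ⟨⟨?_, ?_⟩, ?_, ?_⟩, ⟨?_, ?_⟩, ?_, ?_⟩ <;>
    linarith
end

section
/- The element φ_S = ½((s₀₀ − s₁₀) ⊗ s₀₀ + s₁₁ ⊗ s₁₀ + s₁₀ ⊗ s₀₁) ∈ ℝ³ ⊗ ℝ³ belongs to the maximal tensor product Ŝ ⊗̂ Ŝ, i.e., (h ⊗ h')(φ_S) ≥ 0 for all linear functionals h, h' : ℝ³ → ℝ that are nonnegative on Ŝ and (u ⊗ u)(φ_S) = 1; moreover its outcome probabilities are those of the PR-box: (π₀ ⊗ π₀)(φ_S) = (π₀ ⊗ π₁)(φ_S) = (π₁ ⊗ π₀)(φ_S) = 1/2, (π₁ ⊗ π₁)(φ_S) = 0, and (π₀ ⊗ u)(φ_S) = (u ⊗ π₀)(φ_S) = (π₁ ⊗ u)(φ_S) = (u ⊗ π₁)(φ_S) = 1/2. In particular, the CHSH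 quantity X = Σ_{C,D} ±((2π_C − u) ⊗ (2π_D − u))(φ_S) with the minus sign only on (π₁, π₁) equals 4. -/
open TensorProduct

noncomputable section

/-- Vertices `s i j = (1, i, j)` of the square state space embedded in ℝ³. -/
def sqv (i j : Fin 2) : Fin 3 → ℝ := ![1, ((i : ℕ) : ℝ), ((j : ℕ) : ℝ)]

/-- The square state space `Ŝ = {(1, λ, μ) : λ, μ ∈ [0,1]}` embedded in ℝ³. -/
def Shat : Set (Fin 3 → ℝ) :=
  {v | v 0 = 1 ∧ v 1 ∈ Set.Icc (0:ℝ) 1 ∧ v 2 ∈ Set.Icc (0:ℝ) 1}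

/-- The normalization functional `u(t, λ, μ) = t`. -/
def uF : (Fin 3 → ℝ) →ₗ[ℝ] ℝ := LinearMap.proj 0

/-- The effect `π₀(t, λ, μ) = λ`. -/
def pi0 : (Fin 3 → ℝ) →ₗ[ℝ] ℝ := LinearMap.proj 1

/-- The effect `π₁(t, λ, μ) = μ`. -/
def pi1 : (Fin 3 → ℝ) →ₗ[ℝ] ℝ := LinearMap.proj 2

/-- Evaluation of the functional `h ⊗ h'` on an element of `V ⊗ V`. -/
def tpair {V : Type*} [AddCommGroup V] [Module ℝ V] (h h' : V →ₗ[ℝ] ℝ) :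
    TensorProduct ℝ V V →ₗ[ℝ] ℝ :=
  TensorProduct.lift ((LinearMap.mul ℝ ℝ).compl₁₂ h h')

/-- The PR state `φ_S = ½((s₀₀ − s₁₀) ⊗ s₀₀ + s₁₁ ⊗ s₁₀ + s₁₀ ⊗ s₀₁)`. -/
def phiS : TensorProduct ℝ (Fin 3 → ℝ) (Fin 3 → ℝ) :=
  (1/2 : ℝ) • ((sqv 0 0 - sqv 1 0) ⊗ₜ[ℝ] sqv 0 0 + sqv 1 1 ⊗ₜ[ℝ] sqv 1 0
    + sqv 1 0 ⊗ₜ[ℝ] sqv 0 1)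

theorem tpair_phiS (h h' : (Fin 3 → ℝ) →ₗ[ℝ] ℝ) :
    tpair h h' phiS = 1 / 2 * ((h (sqv 0 0) - h (sqv 1 0)) * h' (sqv 0 0)
      + h (sqv 1 1) * h' (sqv 1 0) + h (sqv 1 0) * h' (sqv 0 1)) := by
  simp [tpair, phiS]
  ring

theorem sqv_mem_Shat (i j : Fin 2) : sqv i j ∈ Shat := by
  fin_cases i <;> fin_cases j <;> simp [sqv, Shat]

/-- The two diagonals of the square have the same midpoint. -/
theorem sqv_add_sqv : sqv 0 0 + sqv 1 1 = sqv 1 0 + sqv 0 1 := by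
  ext k
  fin_cases k <;> simp [sqv]

theorem map_sqv_add_map_sqv (h : (Fin 3 → ℝ) →ₗ[ℝ] ℝ) :
    h (sqv 0 0) + h (sqv 1 1) = h (sqv 1 0) + h (sqv 0 1) := by
  rw [← map_add, ← map_add, sqv_add_sqv]

theorem tpair_phiS_nonneg (h h' : (Fin 3 → ℝ) →ₗ[ℝ] ℝ) (hh : ∀ v ∈ Shat, 0 ≤ h v)
    (hh' : ∀ v ∈ Shat, 0 ≤ h' v) : 0 ≤ tpair h h' phiS := by
  have a (i j : Fin 2) := hh _ (sqv_mem_Shat i j)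
  have b (i j : Fin 2) := hh' _ (sqv_mem_Shat i j)
  have ea := map_sqv_add_map_sqv h
  have eb := map_sqv_add_map_sqv h'
  rw [tpair_phiS]
  rcases le_total (h' (sqv 0 0)) (h' (sqv 0 1)) with hle | hle
  · linarith [mul_nonneg (a 0 0) (b 0 0), mul_nonneg (a 1 1) (b 1 0),
      mul_nonneg (a 1 0) (sub_nonneg.2 hle)]
  · have key : (h (sqv 0 0) - h (sqv 1 0)) * h' (sqv 0 0)
        + h (sqv 1 1) * h' (sqv 1 0) + h (sqv 1 0) * h' (sqv 0 1)
        = h (sqv 0 0) * h' (sqv 0 1) + h (sqv 1 1) * h' (sqv 1 1)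
          + h (sqv 0 1) * (h' (sqv 0 0) - h' (sqv 0 1)) := by
      linear_combination (h' (sqv 0 0) - h' (sqv 0 1)) * ea - h (sqv 1 1) * eb
    linarith [mul_nonneg (a 0 0) (b 0 1), mul_nonneg (a 1 1) (b 1 1),
      mul_nonneg (a 0 1) (sub_nonneg.2 hle)]

/-- `φ_S` belongs to the maximal tensor product `Ŝ ⊗̂ Ŝ`, its outcome probabilities
are those of the PR-box, and its CHSH quantity equals 4. -/
theorem phiS_implements_PR_box :
    (∀ h h' : (Fin 3 → ℝ) →ₗ[ℝ] ℝ, (∀ v ∈ Shat, 0 ≤ h v) → (∀ v ∈ Shat, 0 ≤ h' v) →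
      0 ≤ tpair h h' phiS) ∧
    tpair uF uF phiS = 1 ∧
    tpair pi0 pi0 phiS = 1/2 ∧ tpair pi0 pi1 phiS = 1/2 ∧
    tpair pi1 pi0 phiS = 1/2 ∧ tpair pi1 pi1 phiS = 0 ∧
    tpair pi0 uF phiS = 1/2 ∧ tpair uF pi0 phiS = 1/2 ∧
    tpair pi1 uF phiS = 1/2 ∧ tpair uF pi1 phiS = 1/2 ∧
    tpair ((2:ℝ) • pi0 - uF) ((2:ℝ) • pi0 - uF) phiS
      + tpair ((2:ℝ) • pi0 - uF) ((2:ℝ) • pi1 - uF) phiS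
      + tpair ((2:ℝ) • pi1 - uF) ((2:ℝ) • pi0 - uF) phiS
      - tpair ((2:ℝ) • pi1 - uF) ((2:ℝ) • pi1 - uF) phiS = 4 := by
  refine ⟨tpair_phiS_nonneg, ?_⟩
  simp only [tpair_phiS]
  simp [uF, pi0, pi1, sqv]
  norm_num

end
end

section
/- Let φ ∈ ℝ³ ⊗ ℝ³ satisfy (h ⊗ h')(φ) ≥ 0 for all linear functionals h, h' : ℝ³ → ℝ nonnegative on Ŝ, (u ⊗ u)(φ) = 1, and suppose the PR-box values hold: (π₀ ⊗ π₀)(φ) = (π₀ ⊗ π₁)(φ) = (π₁ ⊗ π₀)(φ) = 1/2, (π₁ ⊗ π₁)(φ) = 0, (π₀ ⊗ u)(φ) = (u ⊗ π₀)(φ) = (π₁ ⊗ u)(φ) = (u ⊗ π₁)(φ) = 1/2. Then φ = φ_S := ½((s₀₀ − s₁₀) ⊗ s₀₀ + s₁₁ ⊗ s₁₀ + s₁₀ ⊗ s₀₁); i.e., the implementation of the PR-box on the square state space with measurements π₀, π₁ on both sides is unique. -/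
open TensorProduct

noncomputable section

lemma tpair_tmul {V : Type*} [AddCommGroup V] [Module ℝ V] (h h' : V →ₗ[ℝ] ℝ) (x y : V) :
    tpair h h' (x ⊗ₜ[ℝ] y) = h x * h' y := by
  simp [tpair]

/-- Elements of `ℝⁿ ⊗ ℝⁿ` are separated by products of coordinate functionals. -/
lemma ext_tpair_proj {ι : Type*} [Finite ι] {φ ψ : TensorProduct ℝ (ι → ℝ) (ι → ℝ)}
    (h : ∀ i j, tpair (LinearMap.proj i) (LinearMap.proj j) φ =
      tpair (LinearMap.proj i) (LinearMap.proj j) ψ) : φ = ψ := by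
  classical
  have := Fintype.ofFinite ι
  let b := (Pi.basisFun ℝ ι).tensorProduct (Pi.basisFun ℝ ι)
  have hb : ∀ i j χ, b.repr χ (i, j) = tpair (LinearMap.proj i) (LinearMap.proj j) χ := by
    intro i j χ
    induction χ using TensorProduct.induction_on with
    | zero => simp
    | tmul x y => simp [b, tpair_tmul, mul_comm]
    | add x y hx hy => simp [hx, hy]
  refine b.ext_elem ?_
  rintro ⟨i, j⟩
  rw [hb, hb, h]

/-- Uniqueness of the implementation of the PR-box on the square state space: any
element of the maximal tensor product `Ŝ ⊗̂ Ŝ` whose outcome probabilities for the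
measurements `π₀, π₁` on both sides are those of the PR-box equals `φ_S`. -/
theorem PR_box_implementation_on_square_unique
    (φ : TensorProduct ℝ (Fin 3 → ℝ) (Fin 3 → ℝ))
    (hpos : ∀ h h' : (Fin 3 → ℝ) →ₗ[ℝ] ℝ, (∀ v ∈ Shat, 0 ≤ h v) →
      (∀ v ∈ Shat, 0 ≤ h' v) → 0 ≤ tpair h h' φ)
    (hnorm : tpair uF uF φ = 1)
    (h00 : tpair pi0 pi0 φ = 1/2) (h01 : tpair pi0 pi1 φ = 1/2)
    (h10 : tpair pi1 pi0 φ = 1/2) (h11 : tpair pi1 pi1 φ = 0)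
    (hm0 : tpair pi0 uF φ = 1/2) (hm0' : tpair uF pi0 φ = 1/2)
    (hm1 : tpair pi1 uF φ = 1/2) (hm1' : tpair uF pi1 φ = 1/2) :
    φ = phiS := by
  have hS : ∀ h h' : (Fin 3 → ℝ) →ₗ[ℝ] ℝ, tpair h h' phiS =
      (1/2 : ℝ) * (h (sqv 0 0 - sqv 1 0) * h' (sqv 0 0) + h (sqv 1 1) * h' (sqv 1 0)
        + h (sqv 1 0) * h' (sqv 0 1)) := by
    intro h h'
    simp only [phiS, map_smul, map_add, tpair_tmul, smul_eq_mul]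
  rw [uF] at *
  rw [pi0] at *
  rw [pi1] at *
  refine ext_tpair_proj fun i j => ?_
  rw [hS]
  fin_cases i <;> fin_cases j <;> simp [sqv, *] <;> norm_num

end
end
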